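/- Small-u bound for the inner integral H: Let 0 < ε < 1/4 and let θ : ℝ → ℂ be smooth and compactly supported, with Fourier transform θ̂(ξ) = ∫_ℝ e^{−ixξ} θ(x) dx. Then there is a constant C (depending on ε and θ) such that for every σ ∈ ℝ and every u with 0 < |u| ≤ 1, ∫_ℝ |θ̂(uw)| / ( ⟨w−σ⟩^{2ε} ⟨w−2u−σ⟩^{2ε} ) dw ≤ C |u|^{4ε−1}. -/

import Mathlib

open MeasureTheory
open scoped ENNReal

noncomputable section

/-- Japanese bracket `⟨x⟩ = √(1+x²)`. -/
def jap (x : ℝ) : ℝ := Real.sqrt (1 + x ^ 2)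

/-- The Fourier transform `θ̂(ξ) = ∫ e^{-ixξ} θ(x) dx` of `θ : ℝ → ℂ`. -/
def ft1 (θ : ℝ → ℂ) (ξ : ℝ) : ℂ := ∫ x : ℝ, Complex.exp (-Complex.I * ((x * ξ : ℝ) : ℂ)) * θ x

theorem one_le_jap (x : ℝ) : 1 ≤ jap x :=
  Real.one_le_sqrt.2 (by nlinarith [sq_nonneg x])

theorem jap_pos (x : ℝ) : 0 < jap x :=
  zero_lt_one.trans_le (one_le_jap x)

theorem abs_le_jap (x : ℝ) : |x| ≤ jap x :=
  Real.abs_le_sqrt (by linarith)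

theorem continuous_jap : Continuous jap := by
  unfold jap
  fun_prop

theorem ft1_eq_fourier (θ : ℝ → ℂ) (ξ : ℝ) :
    ft1 θ ξ = FourierTransform.fourier θ (ξ / (2 * Real.pi)) := by
  rw [Real.fourier_real_eq_integral_exp_smul, ft1]
  refine integral_congr_ae (.of_forall fun x => ?_)
  have hπ : (Real.pi : ℂ) ≠ 0 := by exact_mod_cast Real.pi_ne_zero
  simp only [smul_eq_mul]
  congr 2
  push_cast
  field_simp

/-- The Fourier transform of a test function is continuous, bounded and integrable. -/
theorem ft1_regularity {θ : ℝ → ℂ} (hθs : ContDiff ℝ (⊤ : ℕ∞) θ) (hθc : HasCompactSupport θ) :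
    Continuous (ft1 θ) ∧ (∃ M, ∀ ξ, ‖ft1 θ ξ‖ ≤ M) ∧ Integrable (ft1 θ) := by
  set F : SchwartzMap ℝ ℂ := FourierTransform.fourier (hθc.toSchwartzMap hθs) with hF
  have h : ft1 θ = fun ξ => F (ξ / (2 * Real.pi)) := by
    funext ξ
    rw [ft1_eq_fourier, hF, SchwartzMap.fourier_coe]
    rfl
  rw [h]
  exact ⟨F.continuous.comp (by fun_prop),
    ⟨_, fun ξ => SchwartzMap.norm_le_seminorm ℝ F _⟩, F.integrable.comp_div (by positivity)⟩

theorem lintegral_ball_abs_rpow_neg_ne_top {a : ℝ} (ha : a < 1) :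
    ∫⁻ x in Metric.ball (0 : ℝ) 1, ENNReal.ofReal (|x| ^ (-a)) ≠ ∞ := by
  have h : IntegrableOn (fun x : ℝ => |x| ^ (-a)) (Metric.ball 0 1) :=
    integrableOn_ball_of_norm_le_rpow (α := a) (C := 1) (by simp) (by simpa using ha)
      (.of_forall fun x => by simp [abs_of_nonneg (Real.rpow_nonneg (abs_nonneg x) (-a))])
      (by fun_prop : Measurable fun x : ℝ => |x| ^ (-a)).aestronglyMeasurable
  exact h.lintegral_lt_top.ne

/-- The Riesz potential of a bounded integrable function is bounded. -/
theorem lintegral_mul_abs_sub_rpow_neg_le {a M : ℝ} (ha : 0 < a) {g : ℝ → ℝ}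
    (hg0 : ∀ v, 0 ≤ g v) (hM : ∀ v, g v ≤ M) (t : ℝ) :
    ∫⁻ v, ENNReal.ofReal (g v * |v - t| ^ (-a)) ≤
      ENNReal.ofReal M * (∫⁻ x in Metric.ball (0 : ℝ) 1, ENNReal.ofReal (|x| ^ (-a))) +
        ∫⁻ v, ENNReal.ofReal (g v) := by
  set k : ℝ → ℝ≥0∞ := (Metric.ball 0 1).indicator fun x => ENNReal.ofReal (|x| ^ (-a)) with hk
  have hkm : Measurable k := Measurable.indicator (by fun_prop) measurableSet_ball
  calc
    _ ≤ ∫⁻ v, (ENNReal.ofReal M * k (v - t) + ENNReal.ofReal (g v)) := by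
      refine lintegral_mono fun v => ?_
      by_cases hv : v - t ∈ Metric.ball (0 : ℝ) 1
      · refine le_add_right ?_
        rw [hk, Set.indicator_of_mem hv, ENNReal.ofReal_mul (hg0 v)]
        gcongr
        exact hM v
      · refine le_add_left (ENNReal.ofReal_le_ofReal ?_)
        have h1 : 1 ≤ |v - t| := by simpa using hv
        exact mul_le_of_le_one_right (hg0 v)
          (Real.rpow_le_one_of_one_le_of_nonpos h1 (by linarith))
    _ = _ := by
      rw [lintegral_add_left (by fun_prop), lintegral_const_mul _ (by fun_prop),
        lintegral_sub_right_eq_self k t, hk, lintegral_indicator measurableSet_ball]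

theorem Real.lintegral_comp_mul_left {f : ℝ → ℝ≥0∞} (hf : Measurable f) {u : ℝ} (hu : u ≠ 0) :
    ∫⁻ w, f (u * w) = ENNReal.ofReal |u⁻¹| * ∫⁻ v, f v := by
  rw [← lintegral_map hf (measurable_const_mul u), Real.map_volume_mul_left hu,
    lintegral_smul_measure, smul_eq_mul]

theorem lintegral_comp_mul_left_mul_jap_le {a u : ℝ} (ha : 0 < a) (hu : u ≠ 0) {g : ℝ → ℝ}
    (hg : Measurable g) (hg0 : ∀ v, 0 ≤ g v) (s : ℝ) :
    ∫⁻ w, ENNReal.ofReal (g (u * w) * jap (w - s) ^ (-a)) ≤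
      ENNReal.ofReal (|u| ^ (a - 1)) *
        ∫⁻ v, ENNReal.ofReal (g v * |v - u * s| ^ (-a)) := by
  have hu' : 0 < |u| := abs_pos.2 hu
  calc
    _ ≤ ∫⁻ w, ENNReal.ofReal (|u| ^ a) *
          ENNReal.ofReal (g (u * w) * |u * w - u * s| ^ (-a)) := by
      refine lintegral_mono_ae ?_
      filter_upwards [Measure.ae_ne volume s] with w hw
      have hws : 0 < |w - s| := abs_pos.2 (sub_ne_zero.2 hw)
      rw [← ENNReal.ofReal_mul (by positivity)]
      refine ENNReal.ofReal_le_ofReal ?_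
      rw [← mul_sub, abs_mul, Real.mul_rpow hu'.le hws.le, mul_left_comm, ← mul_assoc (|u| ^ a),
        ← Real.rpow_add hu', add_neg_cancel, Real.rpow_zero, one_mul]
      exact mul_le_mul_of_nonneg_left
        (Real.rpow_le_rpow_of_nonpos hws (abs_le_jap _) (by linarith)) (hg0 _)
    _ = _ := by
      rw [lintegral_const_mul _ (by fun_prop),
        Real.lintegral_comp_mul_left
          (f := fun v => ENNReal.ofReal (g v * |v - u * s| ^ (-a))) (by fun_prop) hu,
        ← mul_assoc, ← ENNReal.ofReal_mul (by positivity), Real.rpow_sub_one hu'.ne', abs_inv,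
        div_eq_mul_inv]

theorem div_rpow_mul_rpow_le {x y c : ℝ} (hx : 0 < x) (hy : 0 < y) (hc : 0 ≤ c) (p : ℝ) :
    c / (x ^ p * y ^ p) ≤ c * x ^ (-(2 * p)) + c * y ^ (-(2 * p)) := by
  have h (z : ℝ) (hz : 0 < z) : z ^ (-(2 * p)) = ((z ^ p)⁻¹) ^ 2 := by
    rw [← Real.rpow_neg hz.le, ← Real.rpow_mul_natCast hz.le]
    congr 1
    push_cast
    ring
  rw [h x hx, h y hy, div_eq_mul_inv, mul_inv, ← mul_add]
  refine mul_le_mul_of_nonneg_left ?_ hc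
  nlinarith [sq_nonneg ((x ^ p)⁻¹ - (y ^ p)⁻¹), sq_nonneg (x ^ p)⁻¹, sq_nonneg (y ^ p)⁻¹]

/-- **Small-`u` bound for the inner integral `H`**: for `0 < ε < 1/4` and `θ` smooth and
compactly supported, there is `C` such that for all `σ` and all `0 < |u| ≤ 1`,
`∫ |θ̂(uw)| / (⟨w-σ⟩^{2ε} ⟨w-2u-σ⟩^{2ε}) dw ≤ C |u|^{4ε-1}`. -/
theorem H_small_u_bound (ε : ℝ) (hε0 : 0 < ε) (hε : ε < 1/4)
    (θ : ℝ → ℂ) (hθs : ContDiff ℝ (⊤ : ℕ∞) θ) (hθc : HasCompactSupport θ) :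
    ∃ C : ℝ, ∀ σ u : ℝ, 0 < |u| → |u| ≤ 1 →
      (∫⁻ w : ℝ, ENNReal.ofReal
          (‖ft1 θ (u * w)‖ / (jap (w - σ) ^ (2*ε) * jap (w - 2*u - σ) ^ (2*ε))))
        ≤ ENNReal.ofReal (C * |u| ^ (4*ε - 1)) := by
  obtain ⟨hcont, ⟨M, hM⟩, hint⟩ := ft1_regularity hθs hθc
  have ha : 0 < 2 * (2 * ε) := by linarith
  have hg : Measurable fun v => ‖ft1 θ v‖ := hcont.norm.measurable
  set K : ℝ≥0∞ := ENNReal.ofReal M *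
      (∫⁻ x in Metric.ball (0 : ℝ) 1, ENNReal.ofReal (|x| ^ (-(2 * (2 * ε))))) +
    ∫⁻ v, ENNReal.ofReal ‖ft1 θ v‖ with hK
  have hKtop : K ≠ ∞ := ENNReal.add_ne_top.2
    ⟨ENNReal.mul_ne_top ENNReal.ofReal_ne_top
      (lintegral_ball_abs_rpow_neg_ne_top (by linarith)), hint.norm.lintegral_lt_top.ne⟩
  refine ⟨2 * K.toReal, fun σ u hu _ => ?_⟩
  have hbound (s : ℝ) :
      ∫⁻ w, ENNReal.ofReal (‖ft1 θ (u * w)‖ * jap (w - s) ^ (-(2 * (2 * ε)))) ≤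
        ENNReal.ofReal (|u| ^ (2 * (2 * ε) - 1)) * K :=
    (lintegral_comp_mul_left_mul_jap_le ha (abs_pos.1 hu) hg (fun _ => norm_nonneg _) s).trans
      (mul_le_mul_right
        (lintegral_mul_abs_sub_rpow_neg_le ha (fun _ => norm_nonneg _) hM _) _)
  have hmeas : Measurable fun w =>
      ENNReal.ofReal (‖ft1 θ (u * w)‖ * jap (w - σ) ^ (-(2 * (2 * ε)))) := by
    have := hcont.measurable
    have := continuous_jap.measurable
    fun_prop
  calc
    _ ≤ ∫⁻ w, (ENNReal.ofReal (‖ft1 θ (u * w)‖ * jap (w - σ) ^ (-(2 * (2 * ε)))) +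
          ENNReal.ofReal (‖ft1 θ (u * w)‖ * jap (w - (2 * u + σ)) ^ (-(2 * (2 * ε))))) := by
      refine lintegral_mono fun w => ?_
      rw [← sub_sub]
      exact (ENNReal.ofReal_le_ofReal
        (div_rpow_mul_rpow_le (jap_pos _) (jap_pos _) (norm_nonneg _) _)).trans
          ENNReal.ofReal_add_le
    _ ≤ ENNReal.ofReal (|u| ^ (2 * (2 * ε) - 1)) * K +
          ENNReal.ofReal (|u| ^ (2 * (2 * ε) - 1)) * K := by
      rw [lintegral_add_left hmeas]
      exact add_le_add (hbound _) (hbound _)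
    _ = _ := by
      rw [← two_mul, ENNReal.ofReal_mul (by positivity), ENNReal.ofReal_mul zero_le_two,
        ENNReal.ofReal_toReal hKtop, ENNReal.ofReal_ofNat, mul_assoc, mul_comm K,
        show 2 * (2 * ε) = 4 * ε by ring]

end
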